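/- Let τ ∈ ℂ with Im τ > 0 and B ∈ GL_n(ℂ). Let v₁, v₂, v₃ ∈ ℂ be such that v_a − v_b ∉ Σ_B for all a ≠ b, and let y₁, y₂, y₃ ∈ ℂ be such that y_c − y_d ∉ Λ for all c ≠ d. Then the tensors r_B(v_a,v_b; y_c,y_d) satisfy the associative Yang–Baxter relation r_B(v₁,v₂;y₁,y₂)¹² · r_B(v₁,v₃;y₂,y₃)²³ = r_B(v₁,v₃;y₁,y₃)¹³ · r_B(v₃,v₂;y₁,y₂)¹² + r_B(v₂,v₃;y₂,y₃)²³ · r_B(v₁,v₂;y₁,y₃)¹³, as an identity in A⊗A⊗A, where A = Mat_{n×n}(ℂ). -/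

import Mathlib

open Complex Matrix
open scoped TensorProduct

noncomputable section

/-- π as a complex number. -/
def πc : ℂ := Real.pi

/-- The lattice Λ = ℤ + τℤ ⊂ ℂ. -/
def latticeL (τ : ℂ) : Set ℂ := {x | ∃ m k : ℤ, x = (m : ℂ) + (k : ℂ) * τ}

/-- Σ_B = {λ − λ' : exp(2πiλ), exp(2πiλ') eigenvalues of B} + Λ. -/
def SigmaSet (n : ℕ) (τ : ℂ) (B : Matrix (Fin n) (Fin n) ℂ) : Set ℂ :=
  {x | ∃ l l' : ℂ, Complex.exp (2 * πc * I * l) ∈ spectrum ℂ B ∧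
    Complex.exp (2 * πc * I * l') ∈ spectrum ℂ B ∧
    ∃ w ∈ latticeL τ, x = l - l' + w}

/-- The space of holomorphic matrix-valued functions with Φ(z+1) = Φ(z) and
Φ(z+τ)·B = c(z)·B·Φ(z). -/
def SolSpace (n : ℕ) (τ : ℂ) (B : Matrix (Fin n) (Fin n) ℂ) (c : ℂ → ℂ) :
    Submodule ℂ (ℂ → Matrix (Fin n) (Fin n) ℂ) where
  carrier := {Φ | (∀ i j, Differentiable ℂ fun z => Φ z i j) ∧
    (∀ z, Φ (z + 1) = Φ z) ∧ (∀ z, Φ (z + τ) * B = c z • (B * Φ z))}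
  add_mem' := by
    rintro Φ Ψ ⟨hd, hp, hq⟩ ⟨gd, gp, gq⟩
    refine ⟨fun i j => ?_, fun z => ?_, fun z => ?_⟩
    · show Differentiable ℂ fun z => Φ z i j + Ψ z i j
      exact (hd i j).add (gd i j)
    · show Φ (z + 1) + Ψ (z + 1) = Φ z + Ψ z
      rw [hp, gp]
    · show (Φ (z + τ) + Ψ (z + τ)) * B = c z • (B * (Φ z + Ψ z))
      rw [add_mul, hq, gq, Matrix.mul_add, smul_add]
  zero_mem' := by
    refine ⟨fun i j => ?_, fun z => rfl, fun z => by simp⟩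
    show Differentiable ℂ fun _ => (0 : ℂ)
    exact differentiable_const 0
  smul_mem' := by
    rintro a Φ ⟨hd, hp, hq⟩
    refine ⟨fun i j => ?_, fun z => ?_, fun z => ?_⟩
    · show Differentiable ℂ fun z => a • Φ z i j
      exact (hd i j).const_smul a
    · show a • Φ (z + 1) = a • Φ z
      rw [hp]
    · show (a • Φ (z + τ)) * B = c z • (B * (a • Φ z))
      rw [Matrix.smul_mul, hq, Matrix.mul_smul, smul_comm]

/-- First Jacobi theta function θ₁(z|τ) = 2q^{1/4} Σ_{m≥0} (−1)^m q^{m(m+1)} sin((2m+1)πz),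
with q = exp(πiτ). -/
def theta1 (τ z : ℂ) : ℂ :=
  2 * Complex.exp (πc * I * τ / 4) *
    ∑' m : ℕ, (-1 : ℂ) ^ m * Complex.exp (πc * I * τ * (m * (m + 1))) *
      Complex.sin ((2 * (m : ℂ) + 1) * πc * z)

/-- Third Jacobi theta function θ₃(z|τ) = Σ_{m∈ℤ} exp(πim²τ + 2πimz). -/
def theta3 (τ z : ℂ) : ℂ :=
  ∑' m : ℤ, Complex.exp (πc * I * (m : ℂ) ^ 2 * τ + 2 * πc * I * (m : ℂ) * z)

/-- The Kronecker function σ(u,x) = θ'(0)θ(u+x)/(θ(u)θ(x)). -/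
def kron (τ u x : ℂ) : ℂ :=
  deriv (theta1 τ) 0 * theta1 τ (u + x) / (theta1 τ u * theta1 τ x)

abbrev MatC (n : ℕ) := Matrix (Fin n) (Fin n) ℂ

/-- The canonical isomorphism Mat ⊗ Mat → End(Mat), X ⊗ Y ↦ (Z ↦ Tr(XZ)·Y). -/
def canM (n : ℕ) : (MatC n ⊗[ℂ] MatC n) →ₗ[ℂ] MatC n →ₗ[ℂ] MatC n :=
  TensorProduct.lift <| LinearMap.mk₂ ℂ
    (fun X Y => ((Matrix.traceLinearMap (Fin n) ℂ ℂ).comp (LinearMap.mulLeft ℂ X)).smulRight Y)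
    (fun X X' Y => by ext Z; simp [add_mul, add_smul])
    (fun a X Y => by ext Z; simp [Matrix.smul_mul, smul_smul, mul_assoc])
    (fun X Y Y' => by ext Z; simp [smul_add, mul_add])
    (fun a X Y => by ext Z; simp [smul_comm, mul_left_comm])

/-- `IsRB n τ B v₁ v₂ y₁ y₂ r` says that the tensor `r` corresponds, under the canonical
map can(X⊗Y)(Z) = Tr(XZ)·Y, to the linear map ev_{y₂} ∘ res_{y₁}⁻¹ on the solution space
Sol_{B, v₁−v₂, y₁}; i.e. r is the tensor r_B(v₁,v₂; y₁,y₂) of the main construction. -/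
def IsRB (n : ℕ) (τ : ℂ) (B : Matrix (Fin n) (Fin n) ℂ) (v₁ v₂ y₁ y₂ : ℂ)
    (r : MatC n ⊗[ℂ] MatC n) : Prop :=
  ∀ Φ ∈ SolSpace n τ B (fun z => -Complex.exp (-(2 * πc * I) * (z + (v₁ - v₂) - y₁ + τ))),
    canM n r (Φ y₁) = (theta3 τ (y₂ - y₁ + (τ + 1) / 2))⁻¹ • Φ y₂

/-- t ↦ t¹², i.e. a ⊗ b ↦ a ⊗ b ⊗ 1 in A ⊗ (A ⊗ A). -/
def ins12 (n : ℕ) : MatC n ⊗[ℂ] MatC n →ₐ[ℂ] MatC n ⊗[ℂ] (MatC n ⊗[ℂ] MatC n) :=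
  Algebra.TensorProduct.map (AlgHom.id ℂ _) Algebra.TensorProduct.includeLeft

/-- t ↦ t¹³, i.e. a ⊗ b ↦ a ⊗ 1 ⊗ b in A ⊗ (A ⊗ A). -/
def ins13 (n : ℕ) : MatC n ⊗[ℂ] MatC n →ₐ[ℂ] MatC n ⊗[ℂ] (MatC n ⊗[ℂ] MatC n) :=
  Algebra.TensorProduct.map (AlgHom.id ℂ _) Algebra.TensorProduct.includeRight

/-- t ↦ t²³ = 1 ⊗ t in A ⊗ (A ⊗ A). -/
def ins23 (n : ℕ) : MatC n ⊗[ℂ] MatC n →ₐ[ℂ] MatC n ⊗[ℂ] (MatC n ⊗[ℂ] MatC n) :=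
  Algebra.TensorProduct.includeRight

/-- The `k`-th Fourier coefficient of the restriction of a `1`-periodic function to `ℝ`. -/
def fourierC (k : ℤ) (f : ℂ → ℂ) : ℂ :=
  ∫ x in (0 : ℝ)..1, f x * cexp (-(2 * Real.pi * I * k * x))

theorem integral_add_right_eq {g : ℂ → ℂ} (hg : Differentiable ℂ g) (hp : ∀ z, g (z + 1) = g z)
    (w : ℂ) : ∫ x in (0 : ℝ)..1, g (x + w) = ∫ x in (0 : ℝ)..1, g x := by
  have hrect := Complex.integral_boundary_rect_eq_zero_of_differentiableOn g 0 (1 + w.im * I)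
    hg.differentiableOn
  have hvert : ∀ y : ℝ, g (1 + y * I) = g (0 + y * I) := fun y => by
    rw [← hp (0 + y * I)]; ring_nf
  simp only [zero_re, zero_im, add_re, one_re, mul_re, ofReal_re, I_re, mul_zero, ofReal_im, I_im,
    mul_one, sub_self, add_zero, add_im, one_im, mul_im, zero_add, ofReal_zero, zero_mul,
    ofReal_one, hvert, add_sub_cancel_right, sub_eq_zero] at hrect
  have hper : Function.Periodic (fun x : ℝ => g (x + w.im * I)) 1 := fun x => by
    have := hp (x + w.im * I)
    simp only [ofReal_add, ofReal_one]
    rw [← this]; ring_nf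
  have h := hper.intervalIntegral_add_eq w.re 0
  rw [zero_add, ← hrect] at h
  have hshift := intervalIntegral.integral_comp_add_right (a := 0) (b := 1)
    (fun x : ℝ => g (x + w.im * I)) w.re
  rw [zero_add, add_comm 1 w.re, h] at hshift
  rw [← hshift]
  congr 1
  ext x
  conv_lhs => rw [← re_add_im w, ← add_assoc]
  rw [ofReal_add]

theorem fourierC_comp_add {f : ℂ → ℂ} (hf : Differentiable ℂ f) (hp : ∀ z, f (z + 1) = f z)
    (k : ℤ) (w : ℂ) :
    fourierC k (fun z => f (z + w)) = cexp (2 * Real.pi * I * k * w) * fourierC k f := by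
  have hg : Differentiable ℂ fun z => f z * cexp (-(2 * Real.pi * I * k * z)) := by fun_prop
  have hgp : ∀ z, f (z + 1) * cexp (-(2 * Real.pi * I * k * (z + 1))) =
      f z * cexp (-(2 * Real.pi * I * k * z)) := fun z => by
    rw [hp, show -(2 * Real.pi * I * k * (z + 1)) =
      -(2 * Real.pi * I * k * z) + ((-k : ℤ) : ℂ) * (2 * Real.pi * I) by push_cast; ring,
      Complex.exp_add, Complex.exp_int_mul_two_pi_mul_I, mul_one]
  have := integral_add_right_eq hg hgp w
  rw [fourierC, fourierC, ← this, ← intervalIntegral.integral_const_mul]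
  congr 1
  ext x
  rw [mul_left_comm, ← Complex.exp_add]
  ring_nf

theorem eq_zero_of_fourierC_eq_zero {f : ℂ → ℂ} (hf : Differentiable ℂ f)
    (hp : ∀ z, f (z + 1) = f z) (h : ∀ k, fourierC k f = 0) (z : ℂ) : f z = 0 := by
  have hper : Function.Periodic (fun x : ℝ => f (x + z)) (1 : ℝ) := fun x => by
    simp only [ofReal_add, ofReal_one]
    rw [← hp (x + z)]; ring_nf
  have hcont : Continuous fun x : ℝ => f (x + z) := hf.continuous.comp (by fun_prop)
  let F : C(AddCircle (1 : ℝ), ℂ) := ⟨hper.lift, hcont.quotient_lift _⟩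
  have hF : ∀ x : ℝ, F (x : AddCircle (1 : ℝ)) = f (x + z) := fun x => rfl
  have hcoef : ∀ k, fourierCoeff F k = 0 := fun k => by
    rw [fourierCoeff_eq_intervalIntegral F k 0]
    have := fourierC_comp_add hf hp k z
    rw [h k, mul_zero, fourierC] at this
    simp only [hF, fourier_coe_apply, zero_add, smul_eq_mul]
    refine smul_eq_zero_of_right _ (Eq.trans ?_ this)
    congr 1
    ext x
    rw [mul_comm]
    push_cast
    ring_nf
  have hs := has_pointwise_sum_fourier_series_of_summable (f := F)
    (by rw [show fourierCoeff F = 0 from funext hcoef]; exact summable_zero) ((0 : ℝ) : AddCircle (1 : ℝ))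
  simp only [hcoef, zero_smul] at hs
  have := hs.unique hasSum_zero
  rw [hF] at this
  simpa using this

/-- Entire `1`-periodic functions `f` with `f (z + τ) = κ · exp(-2πiNz) · f z`. -/
structure IsTheta (τ : ℂ) (N : ℕ) (κ : ℂ) (f : ℂ → ℂ) : Prop where
  differentiable : Differentiable ℂ f
  periodic : ∀ z, f (z + 1) = f z
  quasi : ∀ z, f (z + τ) = κ * cexp (-(2 * Real.pi * I * N * z)) * f z

theorem IsTheta.fourierC_add {τ κ : ℂ} {N : ℕ} {f : ℂ → ℂ} (h : IsTheta τ N κ f) (k : ℤ) :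
    cexp (2 * Real.pi * I * k * τ) * fourierC k f = κ * fourierC (k + N) f := by
  rw [← fourierC_comp_add h.differentiable h.periodic, fourierC, fourierC,
    ← intervalIntegral.integral_const_mul]
  congr 1
  ext x
  rw [h.quasi, mul_assoc, mul_assoc, mul_left_comm _ (f x), ← Complex.exp_add]
  push_cast
  ring_nf

theorem IsTheta.eq_zero {τ κ : ℂ} {N : ℕ} {f : ℂ → ℂ} (h : IsTheta τ N κ f) (hκ : κ ≠ 0)
    (hN : 0 < N) (h0 : ∀ k : ℕ, k < N → fourierC k f = 0) (z : ℂ) : f z = 0 := by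
  refine eq_zero_of_fourierC_eq_zero h.differentiable h.periodic (fun k => ?_) z
  have hiff : ∀ k : ℤ, fourierC k f = 0 ↔ fourierC (k + N) f = 0 := fun k => by
    have := h.fourierC_add k
    constructor
    · intro hk
      rw [hk, mul_zero, eq_comm, mul_eq_zero] at this
      exact this.resolve_left hκ
    · intro hk
      rw [hk, mul_zero, mul_eq_zero] at this
      exact this.resolve_left (Complex.exp_ne_zero _)
  have hmul : ∀ (r : ℤ) (m : ℤ), fourierC r f = 0 ↔ fourierC (r + m * N) f = 0 := fun r m => by
    induction m using Int.induction_on with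
    | zero => simp
    | succ i ih => rw [ih, hiff]; ring_nf
    | pred i ih => rw [ih, hiff (r + (-(i : ℤ) - 1) * N)]; ring_nf
  have hNz : (0 : ℤ) < N := by exact_mod_cast hN
  have hk := Int.emod_add_mul_ediv k N
  rw [← hk, mul_comm (N : ℤ), ← hmul]
  obtain ⟨r, hr⟩ := Int.eq_ofNat_of_zero_le (Int.emod_nonneg k hNz.ne')
  rw [hr]
  have := Int.emod_lt_of_pos k hNz
  exact h0 r (by omega)

theorem theta3_eq_jacobiTheta₂ (τ z : ℂ) : theta3 τ z = jacobiTheta₂ z τ := by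
  refine tsum_congr fun m => ?_
  rw [jacobiTheta₂_term, πc]
  ring_nf

theorem fourierC_zero_jacobiTheta₂ {τ : ℂ} (hτ : 0 < τ.im) :
    fourierC 0 (fun z => jacobiTheta₂ z τ) = 1 := by
  have hbound : ∀ (n : ℤ) (x : ℝ), ‖jacobiTheta₂_term n x τ‖ ≤
      Real.exp (-Real.pi * (τ.im * n ^ 2 - 2 * 0 * |n|)) := fun n x =>
    norm_jacobiTheta₂_term_le hτ (by simp) le_rfl n
  have hsum := summable_pow_mul_jacobiTheta₂_term_bound 0 hτ 0
  simp only [pow_zero, one_mul] at hsum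
  have hS := intervalIntegral.hasSum_integral_of_dominated_convergence (μ := MeasureTheory.volume)
    (a := (0 : ℝ)) (b := 1) (F := fun (n : ℤ) (x : ℝ) => jacobiTheta₂_term n x τ)
    (f := fun x : ℝ => jacobiTheta₂ x τ)
    (fun n _ => Real.exp (-Real.pi * (τ.im * n ^ 2 - 2 * 0 * |n|)))
    (fun n => by unfold jacobiTheta₂_term; exact (by fun_prop : Continuous _).aestronglyMeasurable)
    (fun n => .of_forall fun x _ => hbound n x) (.of_forall fun _ _ => hsum)
    (by simp) (.of_forall fun x _ => hasSum_jacobiTheta₂_term x hτ)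
  have hterm : ∀ n : ℤ, ∫ x in (0 : ℝ)..1, jacobiTheta₂_term n x τ = if n = 0 then 1 else 0 := by
    intro n
    split_ifs with hn
    · simp [hn, jacobiTheta₂_term]
    · have hc : (2 * Real.pi * I * n : ℂ) ≠ 0 := by simp [hn, Real.pi_ne_zero]
      simp only [jacobiTheta₂_term, Complex.exp_add, intervalIntegral.integral_mul_const]
      rw [integral_exp_mul_complex hc, ofReal_one, mul_one, ofReal_zero, mul_zero,
        show (2 * Real.pi * I * n : ℂ) = n * (2 * Real.pi * I) by ring,
        Complex.exp_int_mul_two_pi_mul_I]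
      simp
  simp only [hterm] at hS
  have := hS.unique (hasSum_ite_eq 0 1)
  simpa [fourierC] using this

/-- The product `∏ (1 - w pⁿ)` over `n ≥ 0`. -/
def qProd (p w : ℂ) : ℂ := ∏' n : ℕ, (1 + -(w * p ^ n))

theorem summable_qProd {p : ℂ} (hp : ‖p‖ < 1) (w : ℂ) : Summable fun n : ℕ => ‖-(w * p ^ n)‖ := by
  simpa using (summable_geometric_of_lt_one (norm_nonneg _) hp).mul_left ‖w‖

theorem qProd_eq_mul {p : ℂ} (hp : ‖p‖ < 1) (w : ℂ) : qProd p w = (1 - w) * qProd p (p * w) := by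
  have h := multipliable_one_add_of_summable (summable_qProd hp (p * w))
  have h' : HasProd (fun n : ℕ => 1 + -(w * p ^ (n + 1))) (qProd p (p * w)) := by
    convert h.hasProd using 2 with n
    · ring
    · rfl
  have := h'.zero_mul (f := fun n : ℕ => 1 + -(w * p ^ n))
  rw [qProd, this.tprod_eq]
  ring

theorem qProd_ne_zero {p : ℂ} (hp : ‖p‖ < 1) {w : ℂ} (hw : ∀ n : ℕ, w * p ^ n ≠ 1) :
    qProd p w ≠ 0 :=
  tprod_one_add_ne_zero_of_summable
    (fun n h => hw n (by linear_combination -h)) (summable_qProd hp w)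

theorem differentiable_qProd {p : ℂ} (hp : ‖p‖ < 1) : Differentiable ℂ (qProd p) := by
  have h : HasProdLocallyUniformlyOn (fun (n : ℕ) w => 1 + -(w * p ^ n)) (qProd p) Set.univ := by
    apply hasProdLocallyUniformlyOn_of_forall_compact isOpen_univ
    intro K _ hK
    obtain ⟨C, hC⟩ := hK.isBounded.exists_norm_le
    refine Summable.hasProdUniformlyOn_nat_one_add hK (u := fun n => C * ‖p‖ ^ n)
      ((summable_geometric_of_lt_one (norm_nonneg _) hp).mul_left C)
      (.of_forall fun n x hx => ?_) (fun _ => by fun_prop)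
    rw [norm_neg, norm_mul, norm_pow]
    gcongr
    exact hC x hx
  rw [← differentiableOn_univ]
  exact h.differentiableOn (.of_forall fun _ => by
    simpa [Finset.prod_fn] using DifferentiableOn.finsetProd (fun _ _ => by fun_prop)) isOpen_univ

/-- The odd theta function `x ↦ θ₃(x + (τ + 1) / 2)`. -/
def thetaOdd (τ x : ℂ) : ℂ := theta3 τ (x + (τ + 1) / 2)

theorem exp_two_pi_I_add_one (x : ℂ) :
    cexp (2 * Real.pi * I * (x + 1)) = cexp (2 * Real.pi * I * x) := by
  rw [mul_add, mul_one, Complex.exp_add, Complex.exp_two_pi_mul_I, mul_one]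

theorem isTheta_thetaOdd {τ : ℂ} (hτ : 0 < τ.im) :
    IsTheta τ 1 (-cexp (-(2 * Real.pi * I * τ))) (thetaOdd τ) where
  differentiable z := by
    rw [show thetaOdd τ = fun x => jacobiTheta₂ (x + (τ + 1) / 2) τ from
      funext fun x => theta3_eq_jacobiTheta₂ _ _]
    exact (differentiableAt_jacobiTheta₂_fst _ hτ).comp (f := fun z => z + (τ + 1) / 2) z
      (by fun_prop)
  periodic z := by
    rw [thetaOdd, thetaOdd, add_right_comm, theta3_eq_jacobiTheta₂, theta3_eq_jacobiTheta₂,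
      jacobiTheta₂_add_left]
  quasi z := by
    rw [thetaOdd, thetaOdd, add_right_comm, theta3_eq_jacobiTheta₂, theta3_eq_jacobiTheta₂,
      jacobiTheta₂_add_left', show -Real.pi * I * (τ + 2 * (z + (τ + 1) / 2)) =
      -(2 * Real.pi * I * τ) + -(2 * Real.pi * I * (1 : ℕ) * z) - Real.pi * I by push_cast; ring,
      Complex.exp_sub, Complex.exp_add, Complex.exp_pi_mul_I]
    ring

theorem thetaOdd_neg (τ x : ℂ) :
    thetaOdd τ (-x) = -cexp (2 * Real.pi * I * x) * thetaOdd τ x := by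
  have h := jacobiTheta₂_add_left' (x - (τ + 1) / 2) τ
  have h1 := jacobiTheta₂_add_left (x + (τ - 1) / 2) τ
  rw [show x + (τ - 1) / 2 + 1 = x + (τ + 1) / 2 by ring] at h1
  rw [show x - (τ + 1) / 2 + τ = x + (τ - 1) / 2 by ring, ← h1] at h
  rw [thetaOdd, thetaOdd, theta3_eq_jacobiTheta₂, theta3_eq_jacobiTheta₂, ← jacobiTheta₂_neg_left,
    h, neg_mul, ← mul_assoc, ← Complex.exp_add,
    show 2 * Real.pi * I * x + -Real.pi * I * (τ + 2 * (x - (τ + 1) / 2)) = Real.pi * I by ring,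
    Complex.exp_pi_mul_I]
  ring_nf

theorem thetaOdd_zero (τ : ℂ) : thetaOdd τ 0 = 0 := by
  have := thetaOdd_neg τ 0
  simp only [neg_zero, mul_zero, Complex.exp_zero, neg_mul, one_mul] at this
  exact self_eq_neg.mp this

theorem fourierC_lincomb {f g : ℂ → ℂ} (hf : Differentiable ℂ f) (hg : Differentiable ℂ g)
    (a b : ℂ) (k : ℤ) :
    fourierC k (fun z => a * f z + b * g z) = a * fourierC k f + b * fourierC k g := by
  simp only [fourierC]
  rw [← intervalIntegral.integral_const_mul, ← intervalIntegral.integral_const_mul,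
    ← intervalIntegral.integral_add]
  · congr 1
    ext x
    ring
  · exact (by have := hf.continuous; fun_prop : Continuous _).intervalIntegrable _ _
  · exact (by have := hg.continuous; fun_prop : Continuous _).intervalIntegrable _ _

theorem IsTheta.lincomb {τ κ : ℂ} {N : ℕ} {f g : ℂ → ℂ} (hf : IsTheta τ N κ f)
    (hg : IsTheta τ N κ g) (a b : ℂ) : IsTheta τ N κ fun z => a * f z + b * g z where
  differentiable := (hf.differentiable.const_mul a).add (hg.differentiable.const_mul b)
  periodic z := by rw [hf.periodic, hg.periodic]
  quasi z := by rw [hf.quasi, hg.quasi]; ring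

theorem thetaOdd_eq_zero_imp {τ : ℂ} (hτ : 0 < τ.im) {x : ℂ} (hx : thetaOdd τ x = 0) :
    x ∈ latticeL τ := by
  set p := cexp (2 * Real.pi * I * τ) with hp_def
  have hp : ‖p‖ < 1 := UpperHalfPlane.norm_exp_two_pi_I_lt_one ⟨τ, hτ⟩
  have hp0 : p ≠ 0 := Complex.exp_ne_zero _
  let P : ℂ → ℂ := fun z => qProd p (p * cexp (2 * Real.pi * I * z)) *
    qProd p (cexp (-(2 * Real.pi * I * z)))
  have hP : IsTheta τ 1 (-cexp (-(2 * Real.pi * I * τ))) P := by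
    refine ⟨?_, fun z => ?_, fun z => ?_⟩
    · have := differentiable_qProd hp
      fun_prop
    · simp only [P]
      rw [Complex.exp_neg, Complex.exp_neg, exp_two_pi_I_add_one]
    · simp only [P]
      set w := cexp (2 * Real.pi * I * z) with hw
      have hw0 : w ≠ 0 := Complex.exp_ne_zero _
      rw [Complex.exp_neg, Complex.exp_neg, Complex.exp_neg, Complex.exp_neg, mul_add,
        Complex.exp_add, ← hw, ← hp_def, qProd_eq_mul hp (p * w), qProd_eq_mul hp (w * p)⁻¹,
        show 2 * Real.pi * I * (1 : ℕ) * z = 2 * Real.pi * I * z by push_cast; ring, ← hw,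
        show p * (w * p)⁻¹ = w⁻¹ by field_simp, mul_comm w p]
      field_simp
      ring
  have hT := isTheta_thetaOdd hτ
  have h1 : fourierC 0 (thetaOdd τ) = 1 := by
    have h := fourierC_comp_add (f := fun z => jacobiTheta₂ z τ)
      (fun z => differentiableAt_jacobiTheta₂_fst z hτ) (fun z => jacobiTheta₂_add_left z τ) 0
      ((τ + 1) / 2)
    rw [fourierC_zero_jacobiTheta₂ hτ] at h
    simp only [Int.cast_zero, mul_zero, zero_mul, Complex.exp_zero, mul_one] at h
    rw [← h]
    congr 1
    ext z
    rw [thetaOdd, theta3_eq_jacobiTheta₂]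
  have hcomb := (hP.lincomb hT 1 (-fourierC 0 P)).eq_zero
    (neg_ne_zero.mpr (Complex.exp_ne_zero _)) one_pos (fun k hk => by
      obtain rfl : k = 0 := by omega
      rw [Nat.cast_zero, fourierC_lincomb hP.differentiable hT.differentiable, h1]
      ring) x
  rw [hx, mul_zero, add_zero, one_mul] at hcomb
  have hexp : ∀ u : ℂ, cexp (2 * Real.pi * I * u) = 1 → ∃ m : ℤ, u = m := fun u hu => by
    obtain ⟨m, hm⟩ := Complex.exp_eq_one_iff.mp hu
    refine ⟨m, mul_left_cancel₀ Complex.two_pi_I_ne_zero ?_⟩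
    rw [hm]; ring
  rcases mul_eq_zero.mp hcomb with h | h
  · obtain ⟨n, hn⟩ : ∃ n : ℕ, p * cexp (2 * Real.pi * I * x) * p ^ n = 1 := by
      by_contra! hne
      exact qProd_ne_zero hp hne h
    rw [hp_def, ← Complex.exp_nat_mul, ← Complex.exp_add, ← Complex.exp_add,
      show 2 * Real.pi * I * τ + 2 * Real.pi * I * x + n * (2 * Real.pi * I * τ) =
        2 * Real.pi * I * (x + (n + 1) * τ) by ring] at hn
    obtain ⟨m, hm⟩ := hexp _ hn
    exact ⟨m, -(n + 1), by push_cast; linear_combination hm⟩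
  · obtain ⟨n, hn⟩ : ∃ n : ℕ, cexp (-(2 * Real.pi * I * x)) * p ^ n = 1 := by
      by_contra! hne
      exact qProd_ne_zero hp hne h
    rw [hp_def, ← Complex.exp_nat_mul, ← Complex.exp_add,
      show -(2 * Real.pi * I * x) + n * (2 * Real.pi * I * τ) =
        2 * Real.pi * I * (-x + n * τ) by ring] at hn
    obtain ⟨m, hm⟩ := hexp _ hn
    exact ⟨-m, n, by push_cast; linear_combination -hm⟩

theorem countable_latticeL (τ : ℂ) : (latticeL τ).Countable := by
  have : latticeL τ = Set.range fun q : ℤ × ℤ => (q.1 : ℂ) + q.2 * τ := by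
    ext x
    simp [latticeL, eq_comm]
  rw [this]
  exact Set.countable_range _

theorem exists_sub_notMem_latticeL (τ a b : ℂ) :
    ∃ t, t - a ∉ latticeL τ ∧ t - b ∉ latticeL τ := by
  have h : ∀ c, {t | t - c ∈ latticeL τ}.Countable := fun c =>
    (countable_latticeL τ).preimage (sub_left_injective (b := c))
  obtain ⟨t, ht⟩ := ((h a).union (h b)).dense_compl ℂ |>.nonempty
  exact ⟨t, by simpa [not_or] using ht⟩

theorem IsTheta.exists_eq_mul {τ κ : ℂ} {f g : ℂ → ℂ} (hf : IsTheta τ 2 κ f)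
    (hg : IsTheta τ 2 κ g) (hκ : κ ≠ 0)
    (hdet : fourierC 0 f * fourierC 1 g = fourierC 1 f * fourierC 0 g) (hg0 : ∃ z, g z ≠ 0) :
    ∃ α, ∀ z, f z = α * g z := by
  have key : ∀ a b, a * fourierC 0 f + b * fourierC 0 g = 0 →
      a * fourierC 1 f + b * fourierC 1 g = 0 → ∀ z, a * f z + b * g z = 0 := fun a b h0 h1 =>
    (hf.lincomb hg a b).eq_zero hκ two_pos fun k hk => by
      rw [fourierC_lincomb hf.differentiable hg.differentiable]
      interval_cases k
      · exact h0
      · exact h1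
  have aux : ∀ c d, c ≠ 0 → (∀ z, c * f z + d * g z = 0) → ∃ α, ∀ z, f z = α * g z :=
    fun c d hc h => ⟨-d / c, fun z => by field_simp; linear_combination h z⟩
  by_cases h0 : fourierC 0 g = 0
  · by_cases h1 : fourierC 1 g = 0
    · obtain ⟨z, hz⟩ := hg0
      have := key 0 1 (by simp [h0]) (by simp [h1]) z
      exact absurd (by simpa using this) hz
    · exact aux _ _ h1 (key (fourierC 1 g) (-fourierC 1 f) (by linear_combination hdet) (by ring))
  · exact aux _ _ h0 (key (fourierC 0 g) (-fourierC 0 f) (by ring) (by linear_combination -hdet))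

theorem IsTheta.exists_eq_mul_of_common_zero {τ κ : ℂ} {f f₀ f₁ : ℂ → ℂ} (hf : IsTheta τ 2 κ f)
    (hf₀ : IsTheta τ 2 κ f₀) (hf₁ : IsTheta τ 2 κ f₁) (hκ : κ ≠ 0) {y : ℂ} (hy : f y = 0)
    (hy₀ : f₀ y = 0) (hy₁ : f₁ y ≠ 0) (h0 : ∃ z, f₀ z ≠ 0) : ∃ α, ∀ z, f z = α * f₀ z := by
  refine hf.exists_eq_mul hf₀ hκ ?_ h0
  by_contra hdet
  set D := fourierC 0 f * fourierC 1 f₀ - fourierC 1 f * fourierC 0 f₀ with hD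
  have hD0 : D ≠ 0 := sub_ne_zero.mpr hdet
  set a := fourierC 0 f₁ * fourierC 1 f₀ - fourierC 1 f₁ * fourierC 0 f₀
  set b := fourierC 0 f * fourierC 1 f₁ - fourierC 1 f * fourierC 0 f₁
  have hab := hf.lincomb hf₀ a b
  have := (hab.lincomb hf₁ 1 (-D)).eq_zero hκ two_pos (fun k hk => by
    rw [fourierC_lincomb hab.differentiable hf₁.differentiable,
      fourierC_lincomb hf.differentiable hf₀.differentiable]
    interval_cases k <;> simp only [Nat.cast_zero, Nat.cast_one, D, a, b] <;> ring) y
  rw [hy, hy₀] at this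
  simp only [mul_zero, add_zero, zero_add, neg_mul, neg_eq_zero] at this
  exact (mul_ne_zero hD0 hy₁) this

theorem isTheta_mul_thetaOdd {τ : ℂ} (hτ : 0 < τ.im) (s t : ℂ) :
    IsTheta τ 2 (cexp (2 * Real.pi * I * (s - 2 * τ)))
      fun z => thetaOdd τ (z - t) * thetaOdd τ (z - (s - t)) where
  differentiable := by
    have := (isTheta_thetaOdd hτ).differentiable
    fun_prop
  periodic z := by
    rw [add_sub_right_comm, add_sub_right_comm, (isTheta_thetaOdd hτ).periodic,
      (isTheta_thetaOdd hτ).periodic]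
  quasi z := by
    rw [add_sub_right_comm, add_sub_right_comm, (isTheta_thetaOdd hτ).quasi,
      (isTheta_thetaOdd hτ).quasi]
    have : cexp (2 * Real.pi * I * (s - 2 * τ)) * cexp (-(2 * Real.pi * I * (2 : ℕ) * z)) =
        cexp (-(2 * Real.pi * I * τ)) * cexp (-(2 * Real.pi * I * (1 : ℕ) * (z - t))) *
        (cexp (-(2 * Real.pi * I * τ)) * cexp (-(2 * Real.pi * I * (1 : ℕ) * (z - (s - t))))) := by
      simp only [← Complex.exp_add]
      push_cast
      ring_nf
    rw [this]
    ring

theorem thetaOdd_ne_zero {τ : ℂ} (hτ : 0 < τ.im) {x : ℂ} (hx : x ∉ latticeL τ) :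
    thetaOdd τ x ≠ 0 := fun h => hx (thetaOdd_eq_zero_imp hτ h)

theorem neg_mem_latticeL {τ x : ℂ} (hx : x ∈ latticeL τ) : -x ∈ latticeL τ := by
  obtain ⟨m, k, rfl⟩ := hx
  exact ⟨-m, -k, by push_cast; ring⟩

theorem exists_thetaOdd_mul_ne_zero {τ : ℂ} (hτ : 0 < τ.im) (s y : ℂ) :
    ∃ t, thetaOdd τ (y - t) * thetaOdd τ (y - (s - t)) ≠ 0 := by
  obtain ⟨t, ht, ht'⟩ := exists_sub_notMem_latticeL τ y (s - y)
  refine ⟨t, mul_ne_zero (thetaOdd_ne_zero hτ fun h => ht ?_) (thetaOdd_ne_zero hτ fun h => ht' ?_)⟩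
  · simpa using neg_mem_latticeL h
  · convert h using 1
    ring

theorem IsTheta.eq_thetaOdd_mul {τ s y : ℂ} (hτ : 0 < τ.im) {f : ℂ → ℂ}
    (hf : IsTheta τ 2 (cexp (2 * Real.pi * I * (s - 2 * τ))) f) (hy : f y = 0) :
    ∃ α, ∀ z, f z = α * (thetaOdd τ (z - y) * thetaOdd τ (z - (s - y))) := by
  obtain ⟨t, ht⟩ := exists_thetaOdd_mul_ne_zero hτ s y
  obtain ⟨z, hz, hz'⟩ := exists_sub_notMem_latticeL τ y (s - y)
  exact hf.exists_eq_mul_of_common_zero (isTheta_mul_thetaOdd hτ s y)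
    (isTheta_mul_thetaOdd hτ s t) (Complex.exp_ne_zero _) hy (by simp [thetaOdd_zero]) ht
    ⟨z, mul_ne_zero (thetaOdd_ne_zero hτ hz) (thetaOdd_ne_zero hτ hz')⟩

/-- A second order theta function is determined by `s` up to the relation between its values at
`y₁` and `y₂` with `y₁ + y₂ = s`. -/
theorem IsTheta.apply_mul_thetaOdd {τ y₁ y₂ : ℂ} (hτ : 0 < τ.im) {f : ℂ → ℂ}
    (hf : IsTheta τ 2 (cexp (2 * Real.pi * I * (y₁ + y₂ - 2 * τ))) f) :
    f y₂ * thetaOdd τ (y₁ - y₂) = -(f y₁ * thetaOdd τ (y₂ - y₁)) := by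
  obtain ⟨t, ht⟩ := exists_thetaOdd_mul_ne_zero hτ (y₁ + y₂) y₁
  have hg := isTheta_mul_thetaOdd hτ (y₁ + y₂) t
  set g : ℂ → ℂ := fun z => thetaOdd τ (z - t) * thetaOdd τ (z - (y₁ + y₂ - t)) with hg_def
  obtain ⟨α, hα⟩ := (hf.lincomb hg (g y₁) (-f y₁)).eq_thetaOdd_mul hτ (y := y₁) (by ring)
  have h2 := hα y₂
  rw [show y₂ - (y₁ + y₂ - y₁) = 0 by ring, thetaOdd_zero, mul_zero, mul_zero] at h2
  refine mul_left_cancel₀ ht ?_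
  change g y₁ * _ = g y₁ * _
  have h3 : g y₂ * thetaOdd τ (y₁ - y₂) = -(g y₁ * thetaOdd τ (y₂ - y₁)) := by
    simp only [hg_def]
    have e1 : y₂ - (y₁ + y₂ - t) = -(y₁ - t) := by ring
    have e2 : y₁ - (y₁ + y₂ - t) = -(y₂ - t) := by ring
    have e3 : y₁ - y₂ = -(y₂ - y₁) := by ring
    rw [e1, e2, e3, thetaOdd_neg, thetaOdd_neg, thetaOdd_neg]
    have : cexp (2 * Real.pi * I * (y₂ - t)) =
        cexp (2 * Real.pi * I * (y₁ - t)) * cexp (2 * Real.pi * I * (y₂ - y₁)) := by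
      rw [← Complex.exp_add]
      ring_nf
    rw [this]
    ring
  linear_combination thetaOdd τ (y₁ - y₂) * h2 + f y₁ * h3

/-- A nonzero family of vectors satisfying a condition stable under `H ↦ L ∘ H - ν • H` can be
replaced by a nonzero family of eigenvectors of `L` for a single eigenvalue. -/
theorem exists_eigenfamily {V ι : Type*} [AddCommGroup V] [Module ℂ V] [FiniteDimensional ℂ V]
    (L : V →ₗ[ℂ] V) (P : (ι → V) → Prop)
    (hP : ∀ H (ν : ℂ), P H → P fun x => L (H x) - ν • H x) {H : ι → V} (hH : P H)
    (hne : ∃ x, H x ≠ 0) :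
    ∃ (H' : ι → V) (ν : ℂ), P H' ∧ (∃ x, H' x ≠ 0) ∧ ∀ x, L (H' x) = ν • H' x := by
  open Polynomial in
  have key : ∀ (s : Multiset ℂ) (H : ι → V), P H → (∃ x, H x ≠ 0) →
      (∀ x, aeval L (s.map fun a => X - C a).prod (H x) = 0) →
      ∃ (H' : ι → V) (ν : ℂ), P H' ∧ (∃ x, H' x ≠ 0) ∧ ∀ x, L (H' x) = ν • H' x := by
    intro s
    induction s using Multiset.induction_on with
    | empty =>
      rintro H - ⟨x, hx⟩ h
      exact absurd (by simpa using h x) hx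
    | cons a s ih =>
      intro H hH hne h
      by_cases h0 : ∀ x, L (H x) - a • H x = 0
      · exact ⟨H, a, hH, hne, fun x => sub_eq_zero.mp (h0 x)⟩
      · refine ih _ (hP H a hH) (by simpa using h0) fun x => ?_
        have := h x
        rw [Multiset.map_cons, Multiset.prod_cons, mul_comm, map_mul, Module.End.mul_apply] at this
        simpa [Algebra.algebraMap_eq_smul_one] using this
  refine key (minpoly ℂ L).roots H hH hne fun x => ?_
  rw [← (IsAlgClosed.splits (minpoly ℂ L)).eq_prod_roots_of_monic
    (minpoly.monic (Algebra.IsIntegral.isIntegral L)), minpoly.aeval, LinearMap.zero_apply]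

theorem exists_exp_eq {x : ℂ} (hx : x ≠ 0) : ∃ l : ℂ, cexp (2 * Real.pi * I * l) = x :=
  ⟨Complex.log x / (2 * Real.pi * I), by
    rw [mul_div_cancel₀ _ Complex.two_pi_I_ne_zero, Complex.exp_log hx]⟩

/-- An eigenvalue of conjugation by `B` is a quotient of two eigenvalues of `B`. -/
theorem exists_exp_sub_eq_of_conj_eigen {n : ℕ} (u : (MatC n)ˣ) {ν : ℂ} {Y : MatC n} (hY : Y ≠ 0)
    (h : (u : MatC n) * Y = ν • (Y * u)) :
    ∃ l l' : ℂ, cexp (2 * Real.pi * I * l) ∈ spectrum ℂ (u : MatC n) ∧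
      cexp (2 * Real.pi * I * l') ∈ spectrum ℂ (u : MatC n) ∧
      cexp (2 * Real.pi * I * (l - l')) = ν := by
  have hν : ν ≠ 0 := by
    rintro rfl
    exact hY (u.isUnit.mul_right_eq_zero.mp (by rw [h, zero_smul]))
  obtain ⟨H, β, hH, ⟨x, hx⟩, hβ⟩ := exists_eigenfamily (LinearMap.mulLeft ℂ (u : MatC n))
    (fun H : Unit → MatC n => ∀ x, (u : MatC n) * H x = ν • (H x * u))
    (fun H a hH x => by
      simp only [LinearMap.mulLeft_apply]
      rw [mul_sub, Matrix.mul_smul, hH, Matrix.mul_smul, ← mul_assoc, hH, sub_mul, smul_sub,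
        Matrix.smul_mul, Matrix.smul_mul, smul_comm ν a])
    (H := fun _ => Y) (fun _ => h) ⟨(), hY⟩
  have hux := hH x
  have hbx := hβ x
  rw [LinearMap.mulLeft_apply] at hbx
  have hβ0 : β ≠ 0 := by
    rintro rfl
    exact hx (u.isUnit.mul_right_eq_zero.mp (by rw [hbx, zero_smul]))
  obtain ⟨l, hl⟩ := exists_exp_eq hβ0
  obtain ⟨m, hm⟩ := exists_exp_eq (div_ne_zero hβ0 hν)
  refine ⟨l, m, ?_, ?_, ?_⟩
  · rw [hl]
    intro hunit
    refine hx (hunit.mul_right_eq_zero.mp ?_)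
    rw [sub_mul, hbx, Algebra.algebraMap_eq_smul_one, Matrix.smul_mul, one_mul, sub_self]
  · rw [hm]
    intro hunit
    refine hx (hunit.mul_left_eq_zero.mp ?_)
    rw [mul_sub, Algebra.algebraMap_eq_smul_one, Matrix.mul_smul, mul_one, sub_eq_zero, div_eq_inv_mul,
      mul_smul, ← hbx, hux, inv_smul_smul₀ hν]
  · rw [mul_sub, Complex.exp_sub, hl, hm]
    field_simp

theorem mem_SigmaSet_of_conj_eigen {n : ℕ} {τ : ℂ} (u : (MatC n)ˣ) {μ v : ℂ} {Y : MatC n}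
    (hY : Y ≠ 0) (h : (u : MatC n) * Y = cexp (2 * Real.pi * I * μ) • (Y * u))
    (hv : v - μ ∈ latticeL τ) : v ∈ SigmaSet n τ (u : MatC n) := by
  obtain ⟨l, l', hl, hl', he⟩ := exists_exp_sub_eq_of_conj_eigen u hY h
  obtain ⟨k, hk⟩ := Complex.exp_eq_exp_iff_exists_int.mp he
  have hk' : l - l' = μ + k := mul_left_cancel₀ Complex.two_pi_I_ne_zero (by rw [hk]; ring)
  obtain ⟨m, j, hmj⟩ := hv
  exact ⟨l, l', hl, hl', m + ((-k : ℤ) : ℂ) + j * τ, ⟨m - k, j, by push_cast; ring⟩, by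
    push_cast
    linear_combination hmj - hk'⟩

theorem summable_jacobiTheta₂_bound (S r : ℝ) {T : ℝ} (hT : 0 < T) (C : ℝ) :
    Summable fun k : ℤ => Real.exp (-Real.pi * (T * k ^ 2 - 2 * S * |k|)) *
      (C * Real.exp (r * |k|)) := by
  have h := summable_pow_mul_jacobiTheta₂_term_bound (S + r / (2 * Real.pi)) hT 0
  simp only [pow_zero, one_mul] at h
  refine (h.mul_right C).congr fun k => ?_
  rw [mul_left_comm, ← Real.exp_add, mul_comm]
  congr 2
  field_simp
  ring

section CoefficientSeries

variable {τ : ℂ} {a : ℤ → ℂ} {C r : ℝ}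

theorem norm_jacobiTheta₂_term_mul_le (hτ : 0 < τ.im)
    (ha : ∀ k, ‖a k‖ ≤ C * Real.exp (r * |k|)) {S : ℝ} {z : ℂ} (hz : |z.im| ≤ S) (k : ℤ) :
    ‖jacobiTheta₂_term k z τ * a k‖ ≤
      Real.exp (-Real.pi * (τ.im * k ^ 2 - 2 * S * |k|)) * (C * Real.exp (r * |k|)) := by
  rw [norm_mul]
  exact mul_le_mul (norm_jacobiTheta₂_term_le hτ hz le_rfl k) (ha k) (norm_nonneg _)
    (Real.exp_nonneg _)

theorem summable_jacobiTheta₂_term_mul (hτ : 0 < τ.im)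
    (ha : ∀ k, ‖a k‖ ≤ C * Real.exp (r * |k|)) (z : ℂ) :
    Summable fun k => jacobiTheta₂_term k z τ * a k :=
  .of_norm_bounded (summable_jacobiTheta₂_bound |z.im| r hτ C)
    (norm_jacobiTheta₂_term_mul_le hτ ha le_rfl)

theorem differentiable_tsum_jacobiTheta₂_term_mul (hτ : 0 < τ.im)
    (ha : ∀ k, ‖a k‖ ≤ C * Real.exp (r * |k|)) :
    Differentiable ℂ fun z => ∑' k, jacobiTheta₂_term k z τ * a k := by
  intro z
  have hU : IsOpen {x : ℂ | |x.im| < |z.im| + 1} :=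
    isOpen_lt (by fun_prop) continuous_const
  refine (Complex.differentiableOn_tsum_of_summable_norm
    (summable_jacobiTheta₂_bound (|z.im| + 1) r hτ C) (fun k => ?_) hU fun k x hx =>
      norm_jacobiTheta₂_term_mul_le hτ ha (le_of_lt hx) k).differentiableAt
    (hU.mem_nhds (by simp))
  unfold jacobiTheta₂_term
  fun_prop

end CoefficientSeries

theorem norm_mul_apply_le {n : ℕ} (X Y : MatC n) {c : ℝ} (hY : ∀ i j, ‖Y i j‖ ≤ c) (i j : Fin n) :
    ‖(X * Y) i j‖ ≤ (∑ i, ∑ l, ‖X i l‖) * c := by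
  have hc : 0 ≤ c := (norm_nonneg _).trans (hY i j)
  calc ‖(X * Y) i j‖ ≤ ∑ l, ‖X i l‖ * c := by
        rw [Matrix.mul_apply]
        refine norm_sum_le_of_le _ fun l _ => ?_
        rw [norm_mul]
        exact mul_le_mul_of_nonneg_left (hY l j) (norm_nonneg _)
    _ = (∑ l, ‖X i l‖) * c := by rw [Finset.sum_mul]
    _ ≤ _ := by
        refine mul_le_mul_of_nonneg_right ?_ hc
        exact Finset.single_le_sum (f := fun i => ∑ l, ‖X i l‖)
          (fun _ _ => Finset.sum_nonneg fun _ _ => norm_nonneg _) (Finset.mem_univ i)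

theorem norm_mul_apply_le' {n : ℕ} (X Y : MatC n) {c : ℝ} (hX : ∀ i j, ‖X i j‖ ≤ c) (i j : Fin n) :
    ‖(X * Y) i j‖ ≤ (∑ i, ∑ l, ‖Yᵀ i l‖) * c := by
  have := norm_mul_apply_le Yᵀ Xᵀ (c := c) (fun i j => hX j i) j i
  rwa [← Matrix.transpose_mul, Matrix.transpose_apply] at this

theorem exists_norm_pow_conj_le {n : ℕ} (X Y A : MatC n) :
    ∃ r C : ℝ, ∀ (r' : ℝ), r ≤ r' → ∀ (k : ℕ) i j,
      ‖(X ^ k * A * Y ^ k) i j‖ ≤ C * Real.exp (r' * k) := by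
  set x := ∑ i, ∑ l, ‖X i l‖
  set y := ∑ i, ∑ l, ‖Yᵀ i l‖
  refine ⟨x * y, ∑ i, ∑ l, ‖A i l‖, fun r' hr' k => ?_⟩
  induction k with
  | zero =>
    intro i j
    simp only [pow_zero, one_mul, mul_one, Nat.cast_zero, mul_zero, Real.exp_zero]
    refine (Finset.single_le_sum (f := fun l => ‖A i l‖) (fun _ _ => norm_nonneg _)
      (Finset.mem_univ j)).trans ?_
    exact Finset.single_le_sum (f := fun i => ∑ l, ‖A i l‖)
      (fun _ _ => Finset.sum_nonneg fun _ _ => norm_nonneg _) (Finset.mem_univ i)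
  | succ k ih =>
    intro i j
    have h := norm_mul_apply_le' (X * (X ^ k * A * Y ^ k)) Y (norm_mul_apply_le X _ ih) i j
    rw [pow_succ' X, pow_succ Y,
      show X * X ^ k * A * (Y ^ k * Y) = X * (X ^ k * A * Y ^ k) * Y by simp only [mul_assoc]]
    refine h.trans ?_
    have hC : 0 ≤ ∑ i, ∑ l, ‖A i l‖ := by positivity
    have hxy : x * y ≤ Real.exp r' := hr'.trans (by linarith [Real.add_one_le_exp r'])
    have := mul_le_mul_of_nonneg_left hxy (mul_nonneg hC (Real.exp_nonneg (r' * k)))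
    push_cast
    rw [mul_add, mul_one, Real.exp_add]
    change y * (x * _) ≤ _
    linarith

/-- The matrices `B⁻ᵏ A Bᵏ`. -/
def conjPow {n : ℕ} (u : (MatC n)ˣ) (k : ℤ) (A : MatC n) : MatC n :=
  ((u ^ (-k) : (MatC n)ˣ) : MatC n) * A * ((u ^ k : (MatC n)ˣ) : MatC n)

theorem exists_norm_conjPow_le {n : ℕ} (u : (MatC n)ˣ) (A : MatC n) :
    ∃ C r : ℝ, ∀ i j (k : ℤ), ‖conjPow u k A i j‖ ≤ C * Real.exp (r * |k|) := by
  obtain ⟨r₁, C₁, h₁⟩ := exists_norm_pow_conj_le ((u⁻¹ : (MatC n)ˣ) : MatC n) u A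
  obtain ⟨r₂, C₂, h₂⟩ := exists_norm_pow_conj_le (u : MatC n) ((u⁻¹ : (MatC n)ˣ) : MatC n) A
  refine ⟨max C₁ C₂, max r₁ r₂, fun i j k => ?_⟩
  obtain ⟨m, rfl | rfl⟩ := k.eq_nat_or_neg
  · have := h₁ _ (le_max_left r₁ r₂) m i j
    rw [conjPow, _root_.zpow_neg, ← _root_.inv_zpow, zpow_natCast, zpow_natCast, Units.val_pow_eq_pow_val,
      Units.val_pow_eq_pow_val]
    refine this.trans ?_
    simp only [Nat.abs_cast, Int.cast_natCast]
    gcongr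
    exact le_max_left _ _
  · have := h₂ _ (le_max_right r₁ r₂) m i j
    rw [conjPow, neg_neg, _root_.zpow_neg, ← _root_.inv_zpow, zpow_natCast, zpow_natCast,
      Units.val_pow_eq_pow_val, Units.val_pow_eq_pow_val]
    refine this.trans ?_
    simp only [abs_neg, Nat.abs_cast, Int.cast_natCast]
    gcongr
    exact le_max_right _ _

section Existence

variable {n : ℕ} {τ : ℂ}

theorem conjPow_mul_eq (u : (MatC n)ˣ) (k : ℤ) (A : MatC n) :
    conjPow u k A * u = u * conjPow u (k + 1) A := by
  simp only [conjPow]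
  have h : (u : MatC n) * ((u ^ (-(k + 1)) : (MatC n)ˣ) : MatC n) =
      ((u ^ (-k) : (MatC n)ˣ) : MatC n) := by
    rw [← Units.val_mul, ← _root_.zpow_one_add]
    congr 2
    ring
  rw [mul_assoc, ← Units.val_mul, ← _root_.zpow_add_one, ← mul_assoc, ← mul_assoc, h]

theorem conjPow_conj_mul (u : (MatC n)ˣ) (k : ℤ) (A : MatC n) :
    conjPow u k (u * A * ((u⁻¹ : (MatC n)ˣ) : MatC n)) =
      u * conjPow u k A * ((u⁻¹ : (MatC n)ˣ) : MatC n) := by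
  simp only [conjPow]
  have h₁ : ((u ^ (-k) : (MatC n)ˣ) : MatC n) * u = u * ((u ^ (-k) : (MatC n)ˣ) : MatC n) := by
    rw [← Units.val_mul, ← Units.val_mul, ← _root_.zpow_add_one, ← _root_.zpow_one_add, add_comm]
  have h₂ : ((u⁻¹ : (MatC n)ˣ) : MatC n) * ((u ^ k : (MatC n)ˣ) : MatC n) =
      ((u ^ k : (MatC n)ˣ) : MatC n) * ((u⁻¹ : (MatC n)ˣ) : MatC n) := by
    rw [← Units.val_mul, ← Units.val_mul]
    congr 1
    exact ((Commute.refl u).inv_left.zpow_right k).eq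
  rw [← mul_assoc, ← mul_assoc, h₁, mul_assoc _ _ ((u ^ k : (MatC n)ˣ) : MatC n), h₂]
  simp only [mul_assoc]

theorem conjPow_of_eigen (u : (MatC n)ˣ) {ν : ℂ} (hν : ν ≠ 0) {A : MatC n}
    (h : (u : MatC n) * A = ν • (A * u)) (k : ℤ) : conjPow u k A = ν ^ (-k) • A := by
  have step : ∀ k, conjPow u (k + 1) A = ((u⁻¹ : (MatC n)ˣ) : MatC n) * (conjPow u k A * u) := by
    intro k
    rw [conjPow_mul_eq, Units.inv_mul_cancel_left]
  have hA : ((u⁻¹ : (MatC n)ˣ) : MatC n) * (A * u) = ν⁻¹ • A := by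
    rw [Units.inv_mul_eq_iff_eq_mul, Matrix.mul_smul, h, inv_smul_smul₀ hν]
  induction k using Int.induction_on with
  | zero => simp [conjPow]
  | succ k ih =>
    rw [step, ih, Matrix.smul_mul, Matrix.mul_smul, hA, smul_smul, ← zpow_sub_one₀ hν]
    congr 2
    ring
  | pred k ih =>
    have := step (-k - 1)
    rw [sub_add_cancel, ih, ← sub_eq_zero] at this
    have h2 : conjPow u (-k - 1) A = u * (ν ^ (- -(k : ℤ)) • A) * ((u⁻¹ : (MatC n)ˣ) : MatC n) := by
      rw [sub_eq_zero] at this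
      rw [this, Units.mul_inv_cancel_left, Units.mul_inv_cancel_right]
    rw [h2, Matrix.mul_smul, h, smul_smul, Matrix.smul_mul, Units.mul_inv_cancel_right,
      ← zpow_add_one₀ hν]
    congr 2
    ring

/-- The solution of the matrix quasi-periodicity equation with Fourier coefficients built from
`B⁻ᵏ A Bᵏ`. -/
def thetaSol (τ : ℂ) (u : (MatC n)ˣ) (w : ℂ) (A : MatC n) (z : ℂ) : MatC n :=
  .of fun i j => ∑' k, jacobiTheta₂_term k (z + w) τ * conjPow u k A i j

theorem summable_thetaSol (hτ : 0 < τ.im) (u : (MatC n)ˣ) (A : MatC n) (z : ℂ) (i j : Fin n) :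
    Summable fun k => jacobiTheta₂_term k z τ * conjPow u k A i j := by
  obtain ⟨C, r, h⟩ := exists_norm_conjPow_le u A
  exact summable_jacobiTheta₂_term_mul hτ (h i j) z

theorem thetaSol_eq_tsum (hτ : 0 < τ.im) (u : (MatC n)ˣ) (w : ℂ) (A : MatC n) (z : ℂ) :
    HasSum (fun k => jacobiTheta₂_term k (z + w) τ • conjPow u k A) (thetaSol τ u w A z) := 
  Pi.hasSum.mpr fun i => Pi.hasSum.mpr fun j => (summable_thetaSol hτ u A (z + w) i j).hasSum

theorem thetaSol_mem (hτ : 0 < τ.im) (u : (MatC n)ˣ) (v y : ℂ) (A : MatC n) :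
    thetaSol τ u (v - y + (τ + 1) / 2) A ∈ SolSpace n τ (u : MatC n)
      (fun z => -cexp (-(2 * πc * I) * (z + v - y + τ))) := by
  refine ⟨fun i j => ?_, fun z => ?_, fun z => ?_⟩
  · obtain ⟨C, r, h⟩ := exists_norm_conjPow_le u A
    exact (differentiable_tsum_jacobiTheta₂_term_mul hτ (h i j)).comp
      (differentiable_id.add_const _)
  · ext i j
    refine tsum_congr fun k => ?_
    congr 1
    simp only [jacobiTheta₂_term]
    rw [Complex.exp_eq_exp_iff_exists_int]
    exact ⟨k, by ring⟩
  · have h₁ := (thetaSol_eq_tsum hτ u (v - y + (τ + 1) / 2) A (z + τ)).mul_right (u : MatC n)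
    have h₂ := (((Equiv.addRight (1 : ℤ)).hasSum_iff.mpr
      (thetaSol_eq_tsum hτ u (v - y + (τ + 1) / 2) A z)).mul_left (u : MatC n)).const_smul
      (-cexp (-(2 * πc * I) * (z + v - y + τ)))
    refine h₁.unique ?_
    convert h₂ using 1
    funext k
    simp only [Function.comp_apply, Equiv.coe_addRight]
    rw [Matrix.smul_mul, conjPow_mul_eq, Matrix.mul_smul, smul_smul]
    congr 1
    simp only [jacobiTheta₂_term, πc]
    rw [neg_mul, ← neg_one_mul, ← Complex.exp_pi_mul_I, ← Complex.exp_add, ← Complex.exp_add,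
      Complex.exp_eq_exp_iff_exists_int]
    refine ⟨-1, ?_⟩
    push_cast
    ring

theorem thetaSol_of_eigen (u : (MatC n)ˣ) {μ : ℂ} {A : MatC n}
    (h : (u : MatC n) * A = cexp (2 * Real.pi * I * μ) • (A * u)) (w z : ℂ) :
    thetaSol τ u w A z = theta3 τ (z + w - μ) • A := by
  rw [theta3_eq_jacobiTheta₂, jacobiTheta₂]
  ext i j
  simp only [thetaSol, Matrix.of_apply, Matrix.smul_apply, smul_eq_mul]
  rw [← tsum_mul_right]
  refine tsum_congr fun k => ?_
  rw [conjPow_of_eigen u (Complex.exp_ne_zero _) h, Matrix.smul_apply, smul_eq_mul, ← mul_assoc]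
  congr 1
  rw [← Complex.exp_int_mul, jacobiTheta₂_term, jacobiTheta₂_term, ← Complex.exp_add]
  congr 1
  push_cast
  ring

/-- Evaluation of `thetaSol` as a linear map in the coefficient matrix. -/
def thetaSolLinear (hτ : 0 < τ.im) (u : (MatC n)ˣ) (w z : ℂ) : MatC n →ₗ[ℂ] MatC n where
  toFun A := thetaSol τ u w A z
  map_add' A A' := by
    refine (thetaSol_eq_tsum hτ u w (A + A') z).unique ?_
    convert (thetaSol_eq_tsum hτ u w A z).add (thetaSol_eq_tsum hτ u w A' z) using 1
    funext k
    rw [conjPow, mul_add, add_mul, smul_add]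
    rfl
  map_smul' a A := by
    refine (thetaSol_eq_tsum hτ u w (a • A) z).unique ?_
    rw [RingHom.id_apply]
    convert (thetaSol_eq_tsum hτ u w A z).const_smul a using 1
    funext k
    rw [conjPow, Matrix.mul_smul, Matrix.smul_mul, smul_comm]
    rfl

theorem thetaSolLinear_apply (hτ : 0 < τ.im) (u : (MatC n)ˣ) (w z : ℂ) (A : MatC n) :
    thetaSolLinear hτ u w z A = thetaSol τ u w A z := rfl

theorem thetaSol_conj (hτ : 0 < τ.im) (u : (MatC n)ˣ) (w z : ℂ) (A : MatC n) :
    thetaSol τ u w (u * A * ((u⁻¹ : (MatC n)ˣ) : MatC n)) z =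
      u * thetaSol τ u w A z * ((u⁻¹ : (MatC n)ˣ) : MatC n) := by
  refine (thetaSol_eq_tsum hτ u w _ z).unique ?_
  have h := ((thetaSol_eq_tsum hτ u w A z).mul_left (u : MatC n)).mul_right
    ((u⁻¹ : (MatC n)ˣ) : MatC n)
  simp only [Matrix.mul_smul, Matrix.smul_mul, ← conjPow_conj_mul] at h
  exact h

/-- Conjugation by an invertible matrix. -/
def conjLinear (u : (MatC n)ˣ) : MatC n →ₗ[ℂ] MatC n :=
  (LinearMap.mulRight ℂ ((u⁻¹ : (MatC n)ˣ) : MatC n)).comp (LinearMap.mulLeft ℂ (u : MatC n))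

theorem conjLinear_apply (u : (MatC n)ˣ) (A : MatC n) :
    conjLinear u A = u * A * ((u⁻¹ : (MatC n)ˣ) : MatC n) := rfl

theorem mul_eq_smul_of_conjLinear (u : (MatC n)ˣ) {A : MatC n} {ν : ℂ}
    (h : conjLinear u A = ν • A) : (u : MatC n) * A = ν • (A * u) := by
  rw [conjLinear_apply, Units.mul_inv_eq_iff_eq_mul, Matrix.smul_mul] at h
  exact h

theorem ne_zero_of_conjLinear (u : (MatC n)ˣ) {A : MatC n} {ν : ℂ} (hA : A ≠ 0)
    (h : conjLinear u A = ν • A) : ν ≠ 0 := by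
  rintro rfl
  refine hA (u.isUnit.mul_right_eq_zero.mp ?_)
  rw [mul_eq_smul_of_conjLinear u h, zero_smul]

theorem thetaSolLinear_injective (hτ : 0 < τ.im) (u : (MatC n)ˣ) {v : ℂ} (y : ℂ)
    (hv : v ∉ SigmaSet n τ (u : MatC n)) :
    Function.Injective (thetaSolLinear hτ u (v - y + (τ + 1) / 2) y) := by
  rw [injective_iff_map_eq_zero]
  intro A hA
  by_contra hne
  obtain ⟨H, ν, hH, ⟨x, hx⟩, hν⟩ := exists_eigenfamily (conjLinear u)
    (fun H : Unit → MatC n => ∀ x, thetaSolLinear hτ u (v - y + (τ + 1) / 2) y (H x) = 0)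
    (fun H ν hH x => by
      rw [map_sub, map_smul, hH, conjLinear_apply, thetaSolLinear_apply, thetaSol_conj hτ,
        ← thetaSolLinear_apply hτ u, hH]
      simp)
    (H := fun _ => A) (fun _ => hA) ⟨(), hne⟩
  obtain ⟨μ, rfl⟩ := exists_exp_eq (ne_zero_of_conjLinear u hx (hν x))
  have h := mul_eq_smul_of_conjLinear u (hν x)
  have h0 := hH x
  rw [thetaSolLinear_apply, thetaSol_of_eigen u h, smul_eq_zero, or_iff_left hx] at h0
  refine hv (mem_SigmaSet_of_conj_eigen u hx h (thetaOdd_eq_zero_imp hτ ?_))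
  rw [thetaOdd, ← h0]
  congr 1
  ring

theorem exists_mem_SolSpace (hτ : 0 < τ.im) (u : (MatC n)ˣ) {v : ℂ} (y : ℂ)
    (hv : v ∉ SigmaSet n τ (u : MatC n)) (Z : MatC n) :
    ∃ Φ ∈ SolSpace n τ (u : MatC n) (fun z => -cexp (-(2 * πc * I) * (z + v - y + τ))),
      Φ y = Z := by
  obtain ⟨A, hA⟩ := LinearMap.injective_iff_surjective.mp (thetaSolLinear_injective hτ u y hv) Z
  exact ⟨_, thetaSol_mem hτ u v y A, hA⟩

end Existence

section Products

variable {n : ℕ} {τ : ℂ} {c c' : ℂ → ℂ} {Φ Ψ : ℂ → MatC n}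

theorem conjLinear_mul (u : (MatC n)ˣ) (A A' : MatC n) :
    conjLinear u (A * A') = conjLinear u A * conjLinear u A' := by
  simp only [conjLinear_apply, mul_assoc, Units.inv_mul_cancel_left]

theorem apply_add_tau_of_mem (u : (MatC n)ˣ) (hΦ : Φ ∈ SolSpace n τ (u : MatC n) c) (z : ℂ) :
    Φ (z + τ) = c z • conjLinear u (Φ z) := by
  rw [conjLinear_apply, ← Matrix.smul_mul, ← hΦ.2.2 z, Units.mul_inv_cancel_right]

theorem mul_mem_SolSpace (u : (MatC n)ˣ) (hΦ : Φ ∈ SolSpace n τ (u : MatC n) c)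
    (hΨ : Ψ ∈ SolSpace n τ (u : MatC n) c') :
    (fun z => Φ z * Ψ z) ∈ SolSpace n τ (u : MatC n) fun z => c z * c' z := by
  refine ⟨fun i j => ?_, fun z => ?_, fun z => ?_⟩
  · simp only [Matrix.mul_apply]
    exact .fun_sum fun l _ => (hΦ.1 i l).mul (hΨ.1 l j)
  · simp only [hΦ.2.1 z, hΨ.2.1 z]
  · simp only [apply_add_tau_of_mem u hΦ, apply_add_tau_of_mem u hΨ]
    rw [Matrix.smul_mul, Matrix.mul_smul, ← conjLinear_mul, smul_smul, conjLinear_apply,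
      Matrix.smul_mul, Units.inv_mul_cancel_right]

theorem thetaOdd_smul_mem_SolSpace (hτ : 0 < τ.im) {B : MatC n} (y : ℂ)
    (hΦ : Φ ∈ SolSpace n τ B c) :
    (fun z => thetaOdd τ (z - y) • Φ z) ∈
      SolSpace n τ B fun z => -cexp (-(2 * πc * I) * (z - y + τ)) * c z := by
  have hθ := isTheta_thetaOdd hτ
  refine ⟨fun i j => ?_, fun z => ?_, fun z => ?_⟩
  · exact (hθ.differentiable.comp (differentiable_id.sub_const y)).mul (hΦ.1 i j)
  · simp only
    rw [hΦ.2.1, show z + 1 - y = z - y + 1 by ring, hθ.periodic]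
  · simp only
    rw [Matrix.smul_mul, hΦ.2.2, show z + τ - y = z - y + τ by ring, hθ.quasi, Matrix.mul_smul,
      smul_smul, smul_smul, neg_mul, ← Complex.exp_add, πc]
    congr 1
    rw [show -(2 * ↑Real.pi * I * τ) + -(2 * ↑Real.pi * I * ((1 : ℕ) : ℂ) * (z - y)) =
      -(2 * ↑Real.pi * I) * (z - y + τ) by push_cast; ring]
    ring

theorem conjLinear_mem_SolSpace (u : (MatC n)ˣ) (hΦ : Φ ∈ SolSpace n τ (u : MatC n) c) :
    (fun z => conjLinear u (Φ z)) ∈ SolSpace n τ (u : MatC n) c := by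
  refine ⟨fun i j => ?_, fun z => ?_, fun z => ?_⟩
  · simp only [conjLinear_apply, Matrix.mul_apply]
    exact .fun_sum fun l _ => (Differentiable.fun_sum fun m _ => (hΦ.1 m l).const_mul _).mul_const _
  · simp only [hΦ.2.1 z]
  · simp only [apply_add_tau_of_mem u hΦ]
    rw [map_smul, conjLinear_apply u (conjLinear u (Φ z)), Matrix.smul_mul,
      Units.inv_mul_cancel_right]

theorem isTheta_trace_mul (u : (MatC n)ˣ) {v y₁ y₂ : ℂ}
    (hΦ : Φ ∈ SolSpace n τ (u : MatC n) fun z => -cexp (-(2 * πc * I) * (z + -v - y₁ + τ)))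
    (hΨ : Ψ ∈ SolSpace n τ (u : MatC n) fun z => -cexp (-(2 * πc * I) * (z + v - y₂ + τ))) :
    IsTheta τ 2 (cexp (2 * Real.pi * I * (y₁ + y₂ - 2 * τ))) fun z => (Ψ z * Φ z).trace := by
  have h := mul_mem_SolSpace u hΨ hΦ
  refine ⟨?_, fun z => ?_, fun z => ?_⟩
  · simp only [Matrix.trace, Matrix.diag_apply]
    exact .fun_sum fun i _ => h.1 i i
  · exact congrArg Matrix.trace (h.2.1 z)
  · have := apply_add_tau_of_mem u h z
    rw [this, conjLinear_apply, Matrix.trace_smul, Matrix.trace_mul_comm, Units.inv_mul_cancel_left,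
      smul_eq_mul, neg_mul_neg, ← Complex.exp_add, ← Complex.exp_add, πc]
    congr 2
    push_cast
    ring

/-- Skew-symmetry of the evaluation maps, up to theta factors. -/
theorem trace_mul_skew (hτ : 0 < τ.im) (u : (MatC n)ˣ) {v y₁ y₂ : ℂ}
    (hΦ : Φ ∈ SolSpace n τ (u : MatC n) fun z => -cexp (-(2 * πc * I) * (z + -v - y₁ + τ)))
    (hΨ : Ψ ∈ SolSpace n τ (u : MatC n) fun z => -cexp (-(2 * πc * I) * (z + v - y₂ + τ))) :
    (Ψ y₂ * Φ y₂).trace * thetaOdd τ (y₁ - y₂) =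
      -((Ψ y₁ * Φ y₁).trace * thetaOdd τ (y₂ - y₁)) :=
  (isTheta_trace_mul u hΦ hΨ).apply_mul_thetaOdd hτ

/-- A section of degree two with prescribed zeros `y₁`, `y₂` vanishes when the twist is generic. -/
theorem eq_zero_of_two_zeros (hτ : 0 < τ.im) (u : (MatC n)ˣ) {v y₁ y₂ : ℂ}
    (hv : v ∉ SigmaSet n τ (u : MatC n)) (hy : y₂ - y₁ ∉ latticeL τ)
    (hΦ : Φ ∈ SolSpace n τ (u : MatC n)
      fun z => cexp (-(2 * πc * I) * (2 * z + v - y₁ - y₂ + 2 * τ)))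
    (h₁ : Φ y₁ = 0) (h₂ : Φ y₂ = 0) (z : ℂ) : Φ z = 0 := by
  by_contra hne
  obtain ⟨H, ν, ⟨hH, hH₁, hH₂⟩, ⟨x, hx⟩, hν⟩ := exists_eigenfamily (conjLinear u)
    (fun H : ℂ → MatC n => H ∈ SolSpace n τ (u : MatC n)
      (fun z => cexp (-(2 * πc * I) * (2 * z + v - y₁ - y₂ + 2 * τ))) ∧ H y₁ = 0 ∧ H y₂ = 0)
    (fun H ν ⟨hH, hH₁, hH₂⟩ => ⟨Submodule.sub_mem _ (conjLinear_mem_SolSpace u hH)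
      (Submodule.smul_mem _ ν hH), by simp [hH₁], by simp [hH₂]⟩)
    (H := Φ) ⟨hΦ, h₁, h₂⟩ ⟨z, hne⟩
  obtain ⟨μ, rfl⟩ := exists_exp_eq (ne_zero_of_conjLinear u hx (hν x))
  obtain ⟨i, j, hij⟩ : ∃ i j, H x i j ≠ 0 := by
    by_contra! h
    exact hx (Matrix.ext h)
  have hθ : IsTheta τ 2 (cexp (2 * Real.pi * I * (y₁ + y₂ - v + μ - 2 * τ))) fun z => H z i j := by
    refine ⟨hH.1 i j, fun z => by simp only [hH.2.1 z], fun z => ?_⟩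
    rw [apply_add_tau_of_mem u hH, hν, smul_smul, ← Complex.exp_add, Matrix.smul_apply, smul_eq_mul,
      ← Complex.exp_add, πc]
    congr 2
    push_cast
    ring
  obtain ⟨α, hα⟩ := hθ.eq_thetaOdd_mul hτ (y := y₁) (by simp [hH₁])
  have hα0 : α ≠ 0 := by
    rintro rfl
    exact hij (by rw [hα, zero_mul])
  have h := hα y₂
  rw [hH₂, Matrix.zero_apply, eq_comm, mul_eq_zero, or_iff_right hα0, mul_eq_zero,
    or_iff_right (thetaOdd_ne_zero hτ hy)] at h
  refine hv (mem_SigmaSet_of_conj_eigen u hx (mul_eq_smul_of_conjLinear u (hν x))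
    (thetaOdd_eq_zero_imp hτ ?_))
  rw [← h]
  congr 1
  ring

end Products

section Identity

variable {n : ℕ} {τ : ℂ}

/-- The identity between solutions underlying the associative Yang–Baxter relation. -/
theorem solution_identity (hτ : 0 < τ.im) (u : (MatC n)ˣ) {v₁ v₂ v₃ y₁ y₂ : ℂ}
    (hv : v₁ - v₃ ∉ SigmaSet n τ (u : MatC n)) (hy : y₂ - y₁ ∉ latticeL τ)
    {F G K M N : Fin n → Fin n → ℂ → MatC n}
    (hF : ∀ i j, F i j ∈ SolSpace n τ (u : MatC n)
      fun z => -cexp (-(2 * πc * I) * (z + (v₁ - v₂) - y₁ + τ)))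
    (hG : ∀ i j, G i j ∈ SolSpace n τ (u : MatC n)
      fun z => -cexp (-(2 * πc * I) * (z + (v₁ - v₃) - y₂ + τ)))
    (hK : ∀ i j, K i j ∈ SolSpace n τ (u : MatC n)
      fun z => -cexp (-(2 * πc * I) * (z + (v₃ - v₂) - y₁ + τ)))
    (hM : ∀ i j, M i j ∈ SolSpace n τ (u : MatC n)
      fun z => -cexp (-(2 * πc * I) * (z + (v₁ - v₃) - y₁ + τ)))
    (hN : ∀ i j, N i j ∈ SolSpace n τ (u : MatC n)
      fun z => -cexp (-(2 * πc * I) * (z + (v₂ - v₃) - y₂ + τ)))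
    (hF' : ∀ i j, F i j y₁ = Matrix.single i j 1) (hG' : ∀ i j, G i j y₂ = Matrix.single i j 1)
    (hK' : ∀ i j, K i j y₁ = Matrix.single i j 1) (hM' : ∀ i j, M i j y₁ = Matrix.single i j 1)
    (hN' : ∀ i j, N i j y₂ = Matrix.single i j 1) (a b c d : Fin n) (z : ℂ) :
    thetaOdd τ (z - y₁) • ∑ l, F b a y₂ c l • G d l z =
      thetaOdd τ (z - y₂) • ∑ i, K b i y₂ c d • M i a z +
        thetaOdd τ (y₂ - y₁) • (N d c z * F b a z) := by
  set S := SolSpace n τ (u : MatC n)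
    fun z => cexp (-(2 * πc * I) * (2 * z + (v₁ - v₃) - y₁ - y₂ + 2 * τ)) with hS
  set G' : ℂ → MatC n := ∑ l, F b a y₂ c l • G d l with hG'def
  set M' : ℂ → MatC n := ∑ i, K b i y₂ c d • M i a with hM'def
  have hGa : ∀ z, G' z = ∑ l, F b a y₂ c l • G d l z := fun z => by
    simp [hG'def, Finset.sum_apply]
  have hMa : ∀ z, M' z = ∑ i, K b i y₂ c d • M i a z := fun z => by
    simp [hM'def, Finset.sum_apply]
  have e₁ : (fun z => thetaOdd τ (z - y₁) • G' z) ∈ S := by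
    convert thetaOdd_smul_mem_SolSpace hτ y₁ (Submodule.sum_mem _ fun l _ =>
      Submodule.smul_mem _ (F b a y₂ c l) (hG d l)) using 2
    funext z
    rw [neg_mul_neg, ← Complex.exp_add]
    congr 1
    ring
  have e₂ : (fun z => thetaOdd τ (z - y₂) • M' z) ∈ S := by
    convert thetaOdd_smul_mem_SolSpace hτ y₂ (Submodule.sum_mem _ fun i _ =>
      Submodule.smul_mem _ (K b i y₂ c d) (hM i a)) using 2
    funext z
    rw [neg_mul_neg, ← Complex.exp_add]
    congr 1
    ring
  have e₃ : (fun z => N d c z * F b a z) ∈ S := by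
    convert mul_mem_SolSpace u (hN d c) (hF b a) using 2
    funext z
    rw [neg_mul_neg, ← Complex.exp_add]
    congr 1
    ring
  have key := eq_zero_of_two_zeros hτ u hv hy (Submodule.sub_mem _ (Submodule.sub_mem _ e₁ e₂)
    (Submodule.smul_mem _ (thetaOdd τ (y₂ - y₁)) e₃)) ?_ ?_ z
  · simp only [Pi.sub_apply, Pi.smul_apply, hGa, hMa] at key
    rw [sub_sub, sub_eq_zero] at key
    exact key
  · simp only [Pi.sub_apply, Pi.smul_apply, hMa, hM', hF', sub_self, thetaOdd_zero, zero_smul]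
    have skew : ∀ i, thetaOdd τ (y₁ - y₂) * K b i y₂ c d =
        -(thetaOdd τ (y₂ - y₁) * N d c y₁ i b) := fun i => by
      have h := trace_mul_skew (v := v₂ - v₃) hτ u (by simpa using hK b i) (hN d c)
      rw [hN', hK', Matrix.trace_mul_comm (N d c y₁)] at h
      simp only [Matrix.trace_single_mul] at h
      rw [mul_comm, mul_comm (thetaOdd τ (y₂ - y₁))]
      simpa using h
    rw [Finset.smul_sum]
    simp only [smul_smul, skew]
    ext p q
    simp [Matrix.sum_apply, Matrix.mul_apply, Matrix.single_apply, Finset.mul_sum]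
    by_cases h : a = q <;> simp [h]
  · simp only [Pi.sub_apply, Pi.smul_apply, hGa, hG', hN', sub_self, thetaOdd_zero, zero_smul]
    rw [sub_zero, ← smul_sub]
    convert smul_zero _
    ext p q
    simp [Matrix.sum_apply, Matrix.mul_apply, Matrix.single_apply]
    by_cases h : d = p <;> simp [h]

end Identity

section Tensors

variable {n : ℕ}

/-- Contraction of the first tensor factor with a matrix entry. -/
def entryContract (W : Type*) [AddCommGroup W] [Module ℂ W] (a b : Fin n) :
    MatC n ⊗[ℂ] W →ₗ[ℂ] W :=
  (TensorProduct.lid ℂ W).toLinearMap ∘ₗ LinearMap.rTensor W (Matrix.entryLinearMap ℂ ℂ a b)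

theorem entryContract_tmul {W : Type*} [AddCommGroup W] [Module ℂ W] (a b : Fin n) (X : MatC n)
    (w : W) : entryContract W a b (X ⊗ₜ w) = X a b • w := by
  simp [entryContract]

theorem sum_single_tmul_entryContract {W : Type*} [AddCommGroup W] [Module ℂ W]
    (t : MatC n ⊗[ℂ] W) :
    ∑ a, ∑ b, Matrix.single a b (1 : ℂ) ⊗ₜ[ℂ] entryContract W a b t = t := by
  induction t using TensorProduct.induction_on with
  | zero => simp
  | add x y hx hy =>
    simp only [map_add, TensorProduct.tmul_add, Finset.sum_add_distrib, hx, hy]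
  | tmul X w =>
    simp only [entryContract_tmul, ← TensorProduct.smul_tmul, ← TensorProduct.sum_tmul]
    congr 1
    conv_rhs => rw [Matrix.matrix_eq_sum_single X]
    simp [Matrix.smul_single]

theorem ext_entryContract {s t : MatC n ⊗[ℂ] (MatC n ⊗[ℂ] MatC n)}
    (h : ∀ a b c d, entryContract _ c d (entryContract _ a b s) =
      entryContract _ c d (entryContract _ a b t)) : s = t := by
  rw [← sum_single_tmul_entryContract s, ← sum_single_tmul_entryContract t]
  refine Finset.sum_congr rfl fun a _ => Finset.sum_congr rfl fun b _ => ?_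
  rw [← sum_single_tmul_entryContract (entryContract _ a b s),
    ← sum_single_tmul_entryContract (entryContract _ a b t)]
  simp only [h]

theorem canM_tmul (X Y Z : MatC n) : canM n (X ⊗ₜ Y) Z = (X * Z).trace • Y := rfl

theorem canM_tmul_single (X Y : MatC n) (i j : Fin n) :
    canM n (X ⊗ₜ Y) (Matrix.single i j 1) = X j i • Y := by
  rw [canM_tmul, Matrix.trace_mul_comm, Matrix.trace_single_mul]
  simp

set_option synthInstance.maxHeartbeats 1000000 in
theorem tensorCube_add_mul {n : ℕ} (x y z : MatC n ⊗[ℂ] (MatC n ⊗[ℂ] MatC n)) :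
    (x + y) * z = x * z + y * z :=
  LinearMap.map_add₂ (LinearMap.mul ℂ (MatC n ⊗[ℂ] (MatC n ⊗[ℂ] MatC n))) x y z

set_option synthInstance.maxHeartbeats 1000000 in
theorem tensorCube_mul_add {n : ℕ} (x y z : MatC n ⊗[ℂ] (MatC n ⊗[ℂ] MatC n)) :
    x * (y + z) = x * y + x * z :=
  map_add (LinearMap.mul ℂ (MatC n ⊗[ℂ] (MatC n ⊗[ℂ] MatC n)) x) y z

set_option synthInstance.maxHeartbeats 1000000 in
theorem tensorCube_zero_mul {n : ℕ} (x : MatC n ⊗[ℂ] (MatC n ⊗[ℂ] MatC n)) : 0 * x = 0 :=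
  zero_mul x

set_option synthInstance.maxHeartbeats 1000000 in
theorem tensorCube_mul_zero {n : ℕ} (x : MatC n ⊗[ℂ] (MatC n ⊗[ℂ] MatC n)) : x * 0 = 0 :=
  mul_zero x

set_option synthInstance.maxHeartbeats 1000000 in
theorem entryContract_ins12_mul_ins23 (r s : MatC n ⊗[ℂ] MatC n) (a b c d : Fin n) :
    entryContract _ c d (entryContract _ a b (ins12 n r * ins23 n s)) =
      ∑ l, canM n r (Matrix.single b a 1) c l • canM n s (Matrix.single d l 1) := by
  induction r using TensorProduct.induction_on with
  | zero => simp [tensorCube_zero_mul]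
  | add x y hx hy =>
    simp only [map_add, tensorCube_add_mul, hx, hy, LinearMap.add_apply, Matrix.add_apply, add_smul,
      Finset.sum_add_distrib]
  | tmul X Y =>
    induction s using TensorProduct.induction_on with
    | zero => simp [tensorCube_mul_zero]
    | add x y hx hy =>
      simp only [map_add, tensorCube_mul_add, hx, hy, LinearMap.add_apply, smul_add, Finset.sum_add_distrib]
    | tmul Z W =>
      simp only [canM_tmul_single]
      simp [ins12, ins23, entryContract_tmul, Matrix.mul_apply, Finset.smul_sum, Finset.sum_smul,
        smul_smul, mul_assoc]

set_option synthInstance.maxHeartbeats 1000000 in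
theorem entryContract_ins13_mul_ins12 (r s : MatC n ⊗[ℂ] MatC n) (a b c d : Fin n) :
    entryContract _ c d (entryContract _ a b (ins13 n r * ins12 n s)) =
      ∑ i, canM n s (Matrix.single b i 1) c d • canM n r (Matrix.single i a 1) := by
  induction r using TensorProduct.induction_on with
  | zero => simp [tensorCube_zero_mul]
  | add x y hx hy =>
    simp only [map_add, tensorCube_add_mul, hx, hy, LinearMap.add_apply, smul_add, Finset.sum_add_distrib]
  | tmul X Y =>
    induction s using TensorProduct.induction_on with
    | zero => simp [tensorCube_mul_zero]
    | add x y hx hy =>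
      simp only [map_add, tensorCube_mul_add, hx, hy, LinearMap.add_apply, Matrix.add_apply, add_smul,
        Finset.sum_add_distrib]
    | tmul Z W =>
      simp only [canM_tmul_single]
      simp [ins12, ins13, entryContract_tmul, Matrix.mul_apply, Finset.sum_smul,
        smul_smul, mul_comm, mul_left_comm]

set_option synthInstance.maxHeartbeats 1000000 in
theorem entryContract_ins23_mul_ins13 (r s : MatC n ⊗[ℂ] MatC n) (a b c d : Fin n) :
    entryContract _ c d (entryContract _ a b (ins23 n r * ins13 n s)) =
      canM n r (Matrix.single d c 1) * canM n s (Matrix.single b a 1) := by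
  induction r using TensorProduct.induction_on with
  | zero => simp [tensorCube_zero_mul]
  | add x y hx hy => simp only [map_add, tensorCube_add_mul, add_mul, hx, hy, LinearMap.add_apply]
  | tmul X Y =>
    induction s using TensorProduct.induction_on with
    | zero => simp [tensorCube_mul_zero]
    | add x y hx hy => simp only [map_add, tensorCube_mul_add, mul_add, hx, hy, LinearMap.add_apply]
    | tmul Z W =>
      simp only [canM_tmul_single]
      simp [ins23, ins13, entryContract_tmul, smul_smul, mul_comm]

end Tensors

set_option synthInstance.maxHeartbeats 1000000 in
set_option maxHeartbeats 1000000 in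
/-- The tensors r_B(v_a,v_b; y_c,y_d) satisfy the associative Yang–Baxter relation. -/
theorem rB_AYBE (n : ℕ) (τ : ℂ) (hτ : 0 < τ.im)
    (B : Matrix (Fin n) (Fin n) ℂ) (hB : IsUnit B) (v₁ v₂ v₃ y₁ y₂ y₃ : ℂ)
    (hv : ∀ a b : Fin 3, a ≠ b → ![v₁, v₂, v₃] a - ![v₁, v₂, v₃] b ∉ SigmaSet n τ B)
    (hy : ∀ c d : Fin 3, c ≠ d → ![y₁, y₂, y₃] c - ![y₁, y₂, y₃] d ∉ latticeL τ)
    (ra rb rc rd re rf : MatC n ⊗[ℂ] MatC n)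
    (ha : IsRB n τ B v₁ v₂ y₁ y₂ ra)
    (hb : IsRB n τ B v₁ v₃ y₂ y₃ rb)
    (hc : IsRB n τ B v₁ v₃ y₁ y₃ rc)
    (hd : IsRB n τ B v₃ v₂ y₁ y₂ rd)
    (he : IsRB n τ B v₂ v₃ y₂ y₃ re)
    (hf : IsRB n τ B v₁ v₂ y₁ y₃ rf) :
    ins12 n ra * ins23 n rb = ins13 n rc * ins12 n rd + ins23 n re * ins13 n rf := by
  obtain ⟨u, rfl⟩ := hB
  have v₁₂ : v₁ - v₂ ∉ SigmaSet n τ (u : MatC n) := hv 0 1 (by decide)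
  have v₁₃ : v₁ - v₃ ∉ SigmaSet n τ (u : MatC n) := hv 0 2 (by decide)
  have v₃₂ : v₃ - v₂ ∉ SigmaSet n τ (u : MatC n) := hv 2 1 (by decide)
  have v₂₃ : v₂ - v₃ ∉ SigmaSet n τ (u : MatC n) := hv 1 2 (by decide)
  have y₂₁ : y₂ - y₁ ∉ latticeL τ := hy 1 0 (by decide)
  have t₂₁ := thetaOdd_ne_zero hτ y₂₁
  have t₃₁ : thetaOdd τ (y₃ - y₁) ≠ 0 := thetaOdd_ne_zero hτ (hy 2 0 (by decide))
  have t₃₂ : thetaOdd τ (y₃ - y₂) ≠ 0 := thetaOdd_ne_zero hτ (hy 2 1 (by decide))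
  choose F hF hF' using fun i j => exists_mem_SolSpace hτ u y₁ v₁₂ (Matrix.single i j 1)
  choose G hG hG' using fun i j => exists_mem_SolSpace hτ u y₂ v₁₃ (Matrix.single i j 1)
  choose K hK hK' using fun i j => exists_mem_SolSpace hτ u y₁ v₃₂ (Matrix.single i j 1)
  choose M hM hM' using fun i j => exists_mem_SolSpace hτ u y₁ v₁₃ (Matrix.single i j 1)
  choose N hN hN' using fun i j => exists_mem_SolSpace hτ u y₂ v₂₃ (Matrix.single i j 1)
  refine ext_entryContract fun a b c d => ?_
  have key := solution_identity hτ u v₁₃ y₂₁ hF hG hK hM hN hF' hG' hK' hM' hN' a b c d y₃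
  have fold : ∀ x, theta3 τ (x + (τ + 1) / 2) = thetaOdd τ x := fun _ => rfl
  have ha' := fun i j => ha _ (hF i j)
  have hb' := fun i j => hb _ (hG i j)
  have hc' := fun i j => hc _ (hM i j)
  have hd' := fun i j => hd _ (hK i j)
  have he' := fun i j => he _ (hN i j)
  have hf' := fun i j => hf _ (hF i j)
  simp only [hF', hG', hK', hM', hN', fold] at ha' hb' hc' hd' he' hf'
  rw [map_add, map_add, entryContract_ins12_mul_ins23, entryContract_ins13_mul_ins12,
    entryContract_ins23_mul_ins13]
  simp only [ha', hb', hc', hd', he', hf', Matrix.smul_apply, smul_eq_mul, Matrix.smul_mul,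
    Matrix.mul_smul, smul_smul]
  have key' := congrArg
    (fun X => ((thetaOdd τ (y₂ - y₁))⁻¹ * (thetaOdd τ (y₃ - y₁))⁻¹ * (thetaOdd τ (y₃ - y₂))⁻¹) • X)
    key
  simp only [smul_add, smul_smul, Finset.smul_sum] at key'
  refine Eq.trans ?_ (key'.trans (congrArg₂ _ ?_ ?_))
  · refine Finset.sum_congr rfl fun l _ => ?_
    congr 1
    field_simp
  · refine Finset.sum_congr rfl fun l _ => ?_
    congr 1
    field_simp
  · congr 1
    field_simp
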